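/- arXiv:1501.05806 — 2 statements merged into one kernel-verified Lean document; each statement's English description precedes it below -/
import Mathlib

section
/- Let F be a field and let S be a subset of M_3(F) whose generated unital subalgebra is all of M_3(F). Then the F-linear span of all products of between 1 and 4 elements of S is all of M_3(F). In other words, l_0(S) ≤ 4 for every generating set S of M_3(F), so l_0(M_3(F)) = 4. -/
/-- `L_k^0(S)`: the `F`-linear span of all words in `S` of length between `1` and `k`. -/
def wordSpan0 (F : Type*) [Field F] (n k : ℕ) (S : Set (Matrix (Fin n) (Fin n) F)) :
    Submodule F (Matrix (Fin n) (Fin n) F) :=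
  Submodule.span F {M | ∃ w : List (Matrix (Fin n) (Fin n) F),
    1 ≤ w.length ∧ w.length ≤ k ∧ (∀ x ∈ w, x ∈ S) ∧ M = w.prod}

open Matrix

/-- Data attached to a matrix `A` whose trace pairing annihilates all words of length `1` to `4`
in a space `V` of `3 × 3` matrices, where `V` fixes neither a line nor a plane. -/
structure IsObstruction {K : Type*} [Field K] (A : Matrix (Fin 3) (Fin 3) K)
    (V : Submodule K (Matrix (Fin 3) (Fin 3) K)) : Prop where
  one : ∀ x ∈ V, trace (A * x) = 0
  two : ∀ x ∈ V, ∀ y ∈ V, trace (A * (x * y)) = 0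
  three : ∀ x ∈ V, ∀ y ∈ V, ∀ z ∈ V, trace (A * (x * y * z)) = 0
  four : ∀ x ∈ V, ∀ y ∈ V, ∀ z ∈ V, ∀ w ∈ V, trace (A * (x * y * z * w)) = 0
  col : ∀ v : Fin 3 → K, v ≠ 0 → ∃ b ∈ V, ∀ c : K, b *ᵥ v ≠ c • v
  row : ∀ v : Fin 3 → K, v ≠ 0 → ∃ b ∈ V, ∀ c : K, v ᵥ* b ≠ c • v

section Vectors

variable {K : Type*} [Field K]

theorem exists_eq_smul_of_mul_comm {x n : Fin 3 → K} (hn : n ≠ 0)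
    (h : ∀ i j, x i * n j = x j * n i) : ∃ k : K, x = k • n := by
  obtain ⟨i, hi⟩ := Function.ne_iff.mp hn
  refine ⟨x i / n i, funext fun j => ?_⟩
  have := h i j
  simp only [Pi.zero_apply] at hi
  simp only [Pi.smul_apply, smul_eq_mul]
  field_simp
  linear_combination -this

theorem exists_normal {p p' : Fin 3 → K} (hp : p ≠ 0) (h : ∀ c : K, p' ≠ c • p) :
    ∃ n : Fin 3 → K, n ≠ 0 ∧
      ∀ q : Fin 3 → K, q ⬝ᵥ p = 0 → q ⬝ᵥ p' = 0 → ∃ k : K, q = k • n := by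
  have hn : ![p 1 * p' 2 - p 2 * p' 1, p 2 * p' 0 - p 0 * p' 2, p 0 * p' 1 - p 1 * p' 0]
      ≠ 0 := by
    intro h0
    have e0 := congrFun h0 0
    have e1 := congrFun h0 1
    have e2 := congrFun h0 2
    simp at e0 e1 e2
    obtain ⟨k, hk⟩ := exists_eq_smul_of_mul_comm (x := p') hp (by
      intro i j
      fin_cases i <;> fin_cases j <;> simp <;> grind)
    exact h k hk
  refine ⟨_, hn, fun q h1 h2 => exists_eq_smul_of_mul_comm hn ?_⟩
  simp only [dotProduct, Fin.sum_univ_three] at h1 h2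
  intro i j
  fin_cases i <;> fin_cases j <;> simp <;> grind

theorem dotProduct_mulVec_eq_trace (M : Matrix (Fin 3) (Fin 3) K) (u w : Fin 3 → K) :
    w ⬝ᵥ (M *ᵥ u) = trace (M * vecMulVec u w) := by
  rw [mul_vecMulVec, trace_vecMulVec, dotProduct_comm]

theorem det_ne_zero_of_mulVec {P : Matrix (Fin 3) (Fin 3) K}
    (h : ∀ c, P *ᵥ c = 0 → c = 0) : P.det ≠ 0 := by
  intro h0
  obtain ⟨c, hc, hc'⟩ := Matrix.exists_mulVec_eq_zero_iff.mpr h0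
  exact hc (h c hc')

/-- The second coefficient of the characteristic polynomial: the sum of the principal `2 × 2`
minors. -/
def minorSum (a : Matrix (Fin 3) (Fin 3) K) : K :=
  a 0 0 * a 1 1 - a 0 1 * a 1 0 + (a 0 0 * a 2 2 - a 0 2 * a 2 0) +
    (a 1 1 * a 2 2 - a 1 2 * a 2 1)

theorem cayley_hamilton_three (a : Matrix (Fin 3) (Fin 3) K) :
    a * a * a - trace a • (a * a) + minorSum a • a = det a • 1 := by
  ext i j
  fin_cases i <;> fin_cases j <;>
    simp [minorSum, det_fin_three, trace, Matrix.mul_apply, Fin.sum_univ_three] <;> ring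

theorem det_sub_smul_one (a : Matrix (Fin 3) (Fin 3) K) (r : K) :
    det (a - r • 1) = det a - minorSum a * r + trace a * r ^ 2 - r ^ 3 := by
  simp [minorSum, det_fin_three, trace, Fin.sum_univ_three]
  ring

theorem minorSum_sub_smul_one (a : Matrix (Fin 3) (Fin 3) K) (r : K) :
    minorSum (a - r • 1) = minorSum a - 2 * trace a * r + 3 * r ^ 2 := by
  simp [minorSum, trace, Fin.sum_univ_three]
  ring

set_option maxHeartbeats 2000000 in
theorem exists_eq_vecMulVec {a : Matrix (Fin 3) (Fin 3) K} (ha : a ≠ 0)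
    (hs : minorSum a = 0) (hq : a * a = trace a • a) : ∃ u w, a = vecMulVec u w := by
  have hadj : a.adjugate = 0 := by
    have : a.adjugate = a * a - trace a • a + minorSum a • 1 := by
      rw [Matrix.adjugate_fin_three]
      ext i j
      fin_cases i <;> fin_cases j <;>
        simp [minorSum, trace, Matrix.mul_apply, Fin.sum_univ_three] <;> ring
    rw [this, hq, hs]
    simp
  rw [Matrix.adjugate_fin_three] at hadj
  have h00 := congrFun (congrFun hadj 0) 0
  have h01 := congrFun (congrFun hadj 0) 1
  have h02 := congrFun (congrFun hadj 0) 2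
  have h10 := congrFun (congrFun hadj 1) 0
  have h11 := congrFun (congrFun hadj 1) 1
  have h12 := congrFun (congrFun hadj 1) 2
  have h20 := congrFun (congrFun hadj 2) 0
  have h21 := congrFun (congrFun hadj 2) 1
  have h22 := congrFun (congrFun hadj 2) 2
  simp at h00 h01 h02 h10 h11 h12 h20 h21 h22
  have key : ∀ i j k l, a k l * a i j = a k j * a i l := by
    intro i j k l
    fin_cases i <;> fin_cases j <;> fin_cases k <;> fin_cases l <;> simp <;> grind
  obtain ⟨i, j, hij⟩ : ∃ i j, a i j ≠ 0 := by
    by_contra! h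
    exact ha (Matrix.ext h)
  refine ⟨fun k => a k j, fun l => a i l / a i j, Matrix.ext fun k l => ?_⟩
  rw [vecMulVec_apply, ← mul_div_assoc, eq_div_iff hij, key]

end Vectors

namespace IsObstruction

variable {K : Type*} [Field K] {A : Matrix (Fin 3) (Fin 3) K}
  {V : Submodule K (Matrix (Fin 3) (Fin 3) K)}

theorem eq_zero_of_dotProduct (H : IsObstruction A V) {p q : Fin 3 → K} (hp : p ≠ 0)
    (h0 : q ⬝ᵥ p = 0) (h1 : ∀ b ∈ V, q ⬝ᵥ (b *ᵥ p) = 0)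
    (h2 : ∀ b ∈ V, ∀ c ∈ V, q ⬝ᵥ ((b * c) *ᵥ p) = 0) : q = 0 := by
  by_contra hq
  obtain ⟨b, hb, hbp⟩ := H.col p hp
  obtain ⟨n, -, hn⟩ := exists_normal hp hbp
  obtain ⟨k, hk⟩ := hn q h0 (h1 b hb)
  have hk0 : k ≠ 0 := by
    rintro rfl
    exact hq (by simpa using hk)
  obtain ⟨c, hc, hcq⟩ := H.row q hq
  obtain ⟨l, hl⟩ := hn (q ᵥ* c)
    (by rw [← dotProduct_mulVec]; exact h1 c hc)
    (by rw [← dotProduct_mulVec, mulVec_mulVec]; exact h2 c hc b hb)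
  apply hcq (l / k)
  rw [hl, hk, smul_smul, div_mul_cancel₀ _ hk0]

theorem eq_zero_of_vecMulVec (H : IsObstruction A V) {u w : Fin 3 → K}
    (ha : vecMulVec u w ∈ V) (hne : vecMulVec u w ≠ 0) : A = 0 := by
  have hu : u ≠ 0 := by
    rintro rfl
    simp at hne
  have hw : w ≠ 0 := by
    rintro rfl
    simp at hne
  have hwA : w ᵥ* A = 0 := by
    apply H.eq_zero_of_dotProduct hu
    · rw [← dotProduct_mulVec, dotProduct_mulVec_eq_trace]
      exact H.one _ ha
    · intro b hb
      rw [← dotProduct_mulVec, mulVec_mulVec, dotProduct_mulVec_eq_trace, mul_assoc]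
      exact H.two _ hb _ ha
    · intro b hb c hc
      rw [← dotProduct_mulVec, mulVec_mulVec, dotProduct_mulVec_eq_trace, mul_assoc]
      exact H.three _ hb _ hc _ ha
  obtain ⟨y, hy, hwy⟩ := H.row w hw
  have hwyA : (w ᵥ* y) ᵥ* A = 0 := by
    rw [vecMul_vecMul]
    apply H.eq_zero_of_dotProduct hu
    · rw [← dotProduct_mulVec, dotProduct_mulVec_eq_trace, mul_assoc, trace_mul_comm, mul_assoc]
      exact H.two _ ha _ hy
    · intro b hb
      rw [← dotProduct_mulVec, mulVec_mulVec, dotProduct_mulVec_eq_trace, mul_assoc, mul_assoc,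
        trace_mul_comm, mul_assoc]
      exact H.three _ hb _ ha _ hy
    · intro b hb c hc
      rw [← dotProduct_mulVec, mulVec_mulVec, dotProduct_mulVec_eq_trace, mul_assoc, mul_assoc,
        trace_mul_comm, mul_assoc]
      exact H.four _ hb _ hc _ ha _ hy
  obtain ⟨p, hp, hn⟩ := exists_normal hw hwy
  have hcol : ∀ j, ∃ k : K, A.col j = k • p := by
    intro j
    apply hn
    · rw [dotProduct_comm]; exact congrFun hwA j
    · rw [dotProduct_comm]; exact congrFun hwyA j
  choose k hk using hcol
  have hA : A = vecMulVec p k := by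
    ext i j
    have := congrFun (hk j) i
    rw [vecMulVec_apply, mul_comm]
    exact this
  have htr : ∀ x, k ⬝ᵥ (x *ᵥ p) = trace (A * x) := by
    intro x
    rw [dotProduct_mulVec_eq_trace, hA, trace_mul_comm]
  obtain ⟨b, hb, hbp⟩ := H.col p hp
  have hk0 : k = 0 := by
    apply H.eq_zero_of_dotProduct (p := b *ᵥ p) (by simpa using hbp 0)
    · rw [htr]; exact H.one b hb
    · intro c hc
      rw [mulVec_mulVec, htr]; exact H.two c hc b hb
    · intro c hc d hd
      rw [mulVec_mulVec, htr]; exact H.three c hc d hd b hb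
  rw [hA, hk0, vecMulVec_zero]

theorem exists_col_ne (H : IsObstruction A V) (i : Fin 3) :
    ∃ b ∈ V, ∃ j, j ≠ i ∧ b j i ≠ 0 := by
  obtain ⟨b, hb, h⟩ := H.col (Pi.single i 1) (by simp)
  refine ⟨b, hb, ?_⟩
  by_contra! h0
  apply h (b i i)
  ext j
  rw [mulVec_single_one]
  by_cases hj : j = i
  · subst hj; simp
  · simp [hj, h0 j hj]

theorem exists_row_ne (H : IsObstruction A V) (i : Fin 3) :
    ∃ b ∈ V, ∃ j, j ≠ i ∧ b i j ≠ 0 := by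
  obtain ⟨b, hb, h⟩ := H.row (Pi.single i 1) (by simp)
  refine ⟨b, hb, ?_⟩
  by_contra! h0
  apply h (b i i)
  ext j
  rw [single_one_vecMul]
  by_cases hj : j = i
  · subst hj; simp
  · simp [hj, h0 j hj]

theorem conj (H : IsObstruction A V) {P : Matrix (Fin 3) (Fin 3) K} (hP : P.det ≠ 0) :
    IsObstruction (P⁻¹ * A * P)
      (V.comap (LinearMap.mulLeft K P ∘ₗ LinearMap.mulRight K P⁻¹)) := by
  have hu : IsUnit P.det := isUnit_iff_ne_zero.mpr hP
  have h1 : P * P⁻¹ = 1 := mul_nonsing_inv P hu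
  have h2 : P⁻¹ * P = 1 := nonsing_inv_mul P hu
  have tr : ∀ x, trace (P⁻¹ * A * P * x) = trace (A * (P * (x * P⁻¹))) := by
    intro x
    rw [mul_assoc, mul_assoc, trace_mul_comm]
    simp only [mul_assoc]
  have mulc : ∀ x y, P * (x * y * P⁻¹) = P * (x * P⁻¹) * (P * (y * P⁻¹)) := by
    intro x y
    have : P * (x * P⁻¹) * (P * (y * P⁻¹)) = P * x * (P⁻¹ * P) * y * P⁻¹ := by
      simp only [mul_assoc]
    rw [this, h2]
    simp only [mul_assoc, one_mul]
  have conjV : ∀ b ∈ V, P * (P⁻¹ * b * P * P⁻¹) ∈ V := by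
    intro b hb
    rw [mul_assoc _ P, h1, mul_one, ← mul_assoc, h1, one_mul]
    exact hb
  constructor
  · intro x hx
    rw [tr]
    exact H.one _ hx
  · intro x hx y hy
    rw [tr, mulc]
    exact H.two _ hx _ hy
  · intro x hx y hy z hz
    rw [tr, mulc, mulc]
    exact H.three _ hx _ hy _ hz
  · intro x hx y hy z hz w hw
    rw [tr, mulc, mulc, mulc]
    exact H.four _ hx _ hy _ hz _ hw
  · intro v hv
    obtain ⟨b, hb, h⟩ := H.col (P *ᵥ v) (by
      intro h0
      apply hv
      rw [← one_mulVec v, ← h2, ← mulVec_mulVec, h0, mulVec_zero])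
    refine ⟨P⁻¹ * b * P, conjV b hb, fun c hc => h c ?_⟩
    rw [← mulVec_smul, ← hc, mulVec_mulVec, mulVec_mulVec, ← mul_assoc, ← mul_assoc, h1, one_mul]
  · intro v hv
    obtain ⟨b, hb, h⟩ := H.row (v ᵥ* P⁻¹) (by
      intro h0
      apply hv
      rw [← vecMul_one v, ← h2, ← vecMul_vecMul, h0, zero_vecMul])
    refine ⟨P⁻¹ * b * P, conjV b hb, fun c hc => h c ?_⟩
    rw [← smul_vecMul, ← hc, vecMul_vecMul, vecMul_vecMul, mul_assoc _ P, h1, mul_one]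

theorem eq_zero_of_conj (H : IsObstruction A V) {P a J : Matrix (Fin 3) (Fin 3) K}
    (hP : P.det ≠ 0) (ha : a ∈ V) (haP : a * P = P * J)
    (hJ : ∀ A' V', IsObstruction A' V' → J ∈ V' →
      (1 ∈ V → (1 : Matrix (Fin 3) (Fin 3) K) ∈ V') → A' = 0) : A = 0 := by
  have hu : IsUnit P.det := isUnit_iff_ne_zero.mpr hP
  have h1 : P * P⁻¹ = 1 := mul_nonsing_inv P hu
  have h0 := hJ _ _ (H.conj hP)
    (by
      change P * (J * P⁻¹) ∈ V
      rw [← mul_assoc, ← haP, mul_assoc, h1, mul_one]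
      exact ha)
    (by
      intro h
      change P * (1 * P⁻¹) ∈ V
      rwa [one_mul, h1])
  have : P * (P⁻¹ * A * P) * P⁻¹ = A := by
    rw [mul_assoc, mul_assoc _ P, h1, mul_one, ← mul_assoc, h1, one_mul]
  rw [← this, h0, mul_zero, zero_mul]

end IsObstruction

namespace IsObstruction

variable {K : Type*} [Field K] {A : Matrix (Fin 3) (Fin 3) K}
  {V : Submodule K (Matrix (Fin 3) (Fin 3) K)}

theorem eq_zero_of_nilpotent (H : IsObstruction A V)
    (hN : !![0, 1, 0; 0, 0, 1; 0, 0, 0] ∈ V) : A = 0 := by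
  have a31 : A 2 0 = 0 := by
    have := H.two _ hN _ hN
    simpa [-cons_mul, trace, Matrix.mul_apply, Fin.sum_univ_three] using this
  have left : ∀ e, trace (A * (!![0, 1, 0; 0, 0, 1; 0, 0, 0] * e)) = 0 →
      e 1 0 * A 0 0 + e 1 1 * A 1 0 + (e 2 0 * A 0 1 + e 2 1 * A 1 1 + e 2 2 * A 2 1) = 0 := by
    intro e h
    simp [-cons_mul, trace, Matrix.mul_apply, Fin.sum_univ_three, a31] at h
    linear_combination h
  have left2 : ∀ e, trace (A * (!![0, 1, 0; 0, 0, 1; 0, 0, 0] *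
      !![0, 1, 0; 0, 0, 1; 0, 0, 0] * e)) = 0 → e 2 0 * A 0 0 + e 2 1 * A 1 0 = 0 := by
    intro e h
    simp [-cons_mul, trace, Matrix.mul_apply, Fin.sum_univ_three, a31] at h
    linear_combination h
  have right : ∀ e, trace (A * (e * !![0, 1, 0; 0, 0, 1; 0, 0, 0])) = 0 →
      e 0 0 * A 1 0 + e 1 0 * A 1 1 + e 2 0 * A 1 2 + (e 1 1 * A 2 1 + e 2 1 * A 2 2) = 0 := by
    intro e h
    simp [-cons_mul, trace, Matrix.mul_apply, Fin.sum_univ_three, a31] at h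
    linear_combination h
  have right2 : ∀ e, trace (A * (e * !![0, 1, 0; 0, 0, 1; 0, 0, 0] *
      !![0, 1, 0; 0, 0, 1; 0, 0, 0])) = 0 → e 1 0 * A 2 1 + e 2 0 * A 2 2 = 0 := by
    intro e h
    simp [-cons_mul, trace, Matrix.mul_apply, Fin.sum_univ_three, a31] at h
    linear_combination h
  have mid : ∀ e, trace (A * (!![0, 1, 0; 0, 0, 1; 0, 0, 0] * e *
      !![0, 1, 0; 0, 0, 1; 0, 0, 0])) = 0 →
      e 1 0 * A 1 0 + e 2 0 * A 1 1 + e 2 1 * A 2 1 = 0 := by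
    intro e h
    simp [-cons_mul, trace, Matrix.mul_apply, Fin.sum_univ_three, a31] at h
    linear_combination h
  have all : ∀ e, trace (A * e) = 0 →
      e 0 0 * A 0 0 + e 1 1 * A 1 1 + e 2 2 * A 2 2 + e 0 1 * A 1 0 + e 1 2 * A 2 1 +
        e 1 0 * A 0 1 + e 2 1 * A 1 2 + e 2 0 * A 0 2 = 0 := by
    intro e h
    simp [-cons_mul, trace, Matrix.mul_apply, Fin.sum_univ_three, a31] at h
    linear_combination h
  obtain ⟨e, he, l1, l2, r1, a10, a21, a00, a11, a22⟩ : ∃ e, e 2 0 ≠ 0 ∧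
      trace (A * (!![0, 1, 0; 0, 0, 1; 0, 0, 0] * e)) = 0 ∧ trace (A * e) = 0 ∧
      trace (A * (e * !![0, 1, 0; 0, 0, 1; 0, 0, 0])) = 0 ∧
      A 1 0 = 0 ∧ A 2 1 = 0 ∧ A 0 0 = 0 ∧ A 1 1 = 0 ∧ A 2 2 = 0 := by
    by_cases hb : ∃ b ∈ V, b 2 0 ≠ 0
    · obtain ⟨b, hb, hb0⟩ := hb
      have m1 := H.four _ hN _ hN _ hb _ hN
      have m2 := H.four _ hN _ hb _ hN _ hN
      simp [-cons_mul, trace, Matrix.mul_apply, Fin.sum_univ_three, a31, hb0] at m1 m2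
      have a10 : A 1 0 = 0 := by grind
      have a21 : A 2 1 = 0 := by grind
      have e1 := left2 b (H.three _ hN _ hN _ hb)
      have e2 := right2 b (H.three _ hb _ hN _ hN)
      have e3 := mid b (H.three _ hN _ hb _ hN)
      simp [a10, a21, hb0] at e1 e2 e3
      exact ⟨b, hb0, H.two _ hN _ hb, H.one _ hb, H.two _ hb _ hN, a10, a21, e1, e3, e2⟩
    · push Not at hb
      obtain ⟨b, hbV, j, hj, hbj⟩ := H.exists_col_ne 0
      obtain ⟨c, hcV, k, hk, hck⟩ := H.exists_row_ne 2
      have hb1 : b 1 0 ≠ 0 := by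
        fin_cases j
        · simp at hj
        · exact hbj
        · exact absurd (hb b hbV) hbj
      have hc1 : c 2 1 ≠ 0 := by
        fin_cases k
        · exact absurd (hb c hcV) hck
        · exact hck
        · simp at hk
      have hb2 := hb b hbV
      have hc2 := hb c hcV
      have he : (c * b) 2 0 ≠ 0 := by
        simp [Matrix.mul_apply, Fin.sum_univ_three, hb2, hc2, hb1, hc1]
      have a10 : A 1 0 = 0 := by
        have := left2 c (H.three _ hN _ hN _ hcV)
        simpa [hc2, hc1] using this
      have a21 : A 2 1 = 0 := by
        have := right2 b (H.three _ hbV _ hN _ hN)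
        simpa [hb2, hb1] using this
      have a00 : A 0 0 = 0 := by
        have := H.four _ hN _ hN _ hcV _ hbV
        rw [mul_assoc _ c] at this
        simpa [a10, he] using left2 _ this
      have a22 : A 2 2 = 0 := by
        simpa [a21, he] using right2 _ (H.four _ hcV _ hbV _ hN _ hN)
      have a11 : A 1 1 = 0 := by
        simpa [a00, a10, a21, hc2, hc1] using left _ (H.two _ hN _ hcV)
      refine ⟨c * b, he, ?_, H.two _ hcV _ hbV, H.three _ hcV _ hbV _ hN,
        a10, a21, a00, a11, a22⟩
      rw [← mul_assoc _ c b]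
      exact H.three _ hN _ hcV _ hbV
  have a01 : A 0 1 = 0 := by
    simpa [a10, a21, a00, a11, a22, he] using left _ l1
  have a12 : A 1 2 = 0 := by
    simpa [a10, a21, a00, a11, a22, he] using right _ r1
  have a02 : A 0 2 = 0 := by
    simpa [a10, a21, a00, a11, a22, a01, a12, he] using all _ l2
  ext i j
  fin_cases i <;> fin_cases j <;> simp_all

theorem eq_zero_of_jordan (H : IsObstruction A V) {t : K} (ht : t ≠ 0)
    (hN : !![0, 1, 0; 0, 0, 0; 0, 0, t] ∈ V) : A = 0 := by
  have sq : (!![0, 1, 0; 0, 0, 0; 0, 0, t] * !![0, 1, 0; 0, 0, 0; 0, 0, t] :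
      Matrix (Fin 3) (Fin 3) K) = !![0, 0, 0; 0, 0, 0; 0, 0, t * t] := by
    ext i j
    fin_cases i <;> fin_cases j <;> simp [Matrix.mul_apply, Fin.sum_univ_three]
  have a22 : A 2 2 = 0 := by
    have := H.two _ hN _ hN
    rw [sq] at this
    simpa [-cons_mul, trace, Matrix.mul_apply, Fin.sum_univ_three, ht] using this
  have a10 : A 1 0 = 0 := by
    have := H.one _ hN
    simpa [-cons_mul, trace, Matrix.mul_apply, Fin.sum_univ_three, a22] using this
  -- the equations expressing that `A` annihilates `e`, `a² e`, `e a²`, `a e` and `e a`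
  have left2 : ∀ e, trace (A * (!![0, 1, 0; 0, 0, 0; 0, 0, t] *
      !![0, 1, 0; 0, 0, 0; 0, 0, t] * e)) = 0 → e 2 0 * A 0 2 + e 2 1 * A 1 2 = 0 := by
    intro e h
    rw [sq] at h
    simp [-cons_mul, trace, Matrix.mul_apply, Fin.sum_univ_three, a22] at h
    grind
  have right2 : ∀ e, trace (A * (e * !![0, 1, 0; 0, 0, 0; 0, 0, t] *
      !![0, 1, 0; 0, 0, 0; 0, 0, t])) = 0 → e 0 2 * A 2 0 + e 1 2 * A 2 1 = 0 := by
    intro e h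
    rw [mul_assoc e, sq] at h
    simp [-cons_mul, trace, Matrix.mul_apply, Fin.sum_univ_three, a22] at h
    grind
  have left : ∀ e, e 2 0 * A 0 2 + e 2 1 * A 1 2 = 0 →
      trace (A * (!![0, 1, 0; 0, 0, 0; 0, 0, t] * e)) = 0 →
      e 1 0 * A 0 0 + e 1 2 * A 2 0 = 0 := by
    intro e h0 h
    simp [-cons_mul, trace, Matrix.mul_apply, Fin.sum_univ_three, a22, a10] at h
    linear_combination h - t * h0
  have right : ∀ e, e 0 2 * A 2 0 + e 1 2 * A 2 1 = 0 →
      trace (A * (e * !![0, 1, 0; 0, 0, 0; 0, 0, t])) = 0 →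
      e 1 0 * A 1 1 + e 2 0 * A 1 2 = 0 := by
    intro e h0 h
    simp [-cons_mul, trace, Matrix.mul_apply, Fin.sum_univ_three, a22, a10] at h
    linear_combination h - t * h0
  have all : ∀ e, e 2 0 * A 0 2 + e 2 1 * A 1 2 = 0 → e 0 2 * A 2 0 + e 1 2 * A 2 1 = 0 →
      trace (A * e) = 0 → e 0 0 * A 0 0 + e 1 1 * A 1 1 + e 1 0 * A 0 1 = 0 := by
    intro e h0 h1 h
    simp [-cons_mul, trace, Matrix.mul_apply, Fin.sum_univ_three, a22, a10] at h
    linear_combination h - h0 - h1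
  have L2 : ∀ b ∈ V, b 2 0 * A 0 2 + b 2 1 * A 1 2 = 0 := fun b hb =>
    left2 b (H.three _ hN _ hN _ hb)
  have R2 : ∀ b ∈ V, b 0 2 * A 2 0 + b 1 2 * A 2 1 = 0 := fun b hb =>
    right2 b (H.three _ hb _ hN _ hN)
  have LL2 : ∀ b ∈ V, ∀ c ∈ V, (b * c) 2 0 * A 0 2 + (b * c) 2 1 * A 1 2 = 0 := by
    intro b hb c hc
    have := H.four _ hN _ hN _ hb _ hc
    rw [mul_assoc _ b] at this
    exact left2 _ this
  have RR2 : ∀ b ∈ V, ∀ c ∈ V, (b * c) 0 2 * A 2 0 + (b * c) 1 2 * A 2 1 = 0 :=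
    fun b hb c hc => right2 _ (H.four _ hb _ hc _ hN _ hN)
  have l12 : ∀ b ∈ V, b 2 0 * A 1 2 = 0 := by
    intro b hb
    have := H.four _ hN _ hN _ hb _ hN
    rw [sq] at this
    simp [-cons_mul, trace, Matrix.mul_apply, Fin.sum_univ_three, a22] at this
    grind
  have l20 : ∀ b ∈ V, b 1 2 * A 2 0 = 0 := by
    intro b hb
    have := H.four _ hN _ hb _ hN _ hN
    rw [mul_assoc _ _ !![0, 1, 0; 0, 0, 0; 0, 0, t], sq] at this
    simp [-cons_mul, trace, Matrix.mul_apply, Fin.sum_univ_three, a22] at this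
    grind
  obtain ⟨a12, a02⟩ : A 1 2 = 0 ∧ A 0 2 = 0 := by
    by_cases hb : ∃ b ∈ V, b 2 0 ≠ 0
    · obtain ⟨b, hb, hb0⟩ := hb
      have h1 : A 1 2 = 0 := by simpa [hb0] using l12 b hb
      exact ⟨h1, by simpa [h1, hb0] using L2 b hb⟩
    · push Not at hb
      obtain ⟨b, hbV, j, hj, hbj⟩ := H.exists_col_ne 0
      obtain ⟨c, hcV, k, hk, hck⟩ := H.exists_row_ne 2
      have hb1 : b 1 0 ≠ 0 := by
        fin_cases j
        · simp at hj
        · exact hbj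
        · exact absurd (hb b hbV) hbj
      have hc1 : c 2 1 ≠ 0 := by
        fin_cases k
        · exact absurd (hb c hcV) hck
        · exact hck
        · simp at hk
      have h1 : A 1 2 = 0 := by simpa [hb c hcV, hc1] using L2 c hcV
      have h2 := LL2 c hcV b hbV
      exact ⟨h1, by
        simpa [Matrix.mul_apply, Fin.sum_univ_three, hb b hbV, hb c hcV, hb1, hc1, h1] using h2⟩
  obtain ⟨a20, a21⟩ : A 2 0 = 0 ∧ A 2 1 = 0 := by
    by_cases hb : ∃ b ∈ V, b 1 2 ≠ 0
    · obtain ⟨b, hb, hb0⟩ := hb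
      have h1 : A 2 0 = 0 := by simpa [hb0] using l20 b hb
      exact ⟨h1, by simpa [h1, hb0] using R2 b hb⟩
    · push Not at hb
      obtain ⟨b, hbV, j, hj, hbj⟩ := H.exists_row_ne 1
      obtain ⟨c, hcV, k, hk, hck⟩ := H.exists_col_ne 2
      have hb1 : b 1 0 ≠ 0 := by
        fin_cases j
        · exact hbj
        · simp at hj
        · exact absurd (hb b hbV) hbj
      have hc1 : c 0 2 ≠ 0 := by
        fin_cases k
        · exact hck
        · exact absurd (hb c hcV) hck
        · simp at hk
      have h1 : A 2 0 = 0 := by simpa [hb c hcV, hc1] using R2 c hcV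
      have h2 := RR2 b hbV c hcV
      exact ⟨h1, by
        simpa [Matrix.mul_apply, Fin.sum_univ_three, hb b hbV, hb c hcV, hb1, hc1, h1] using h2⟩
  obtain ⟨e, he, e1, e2, e3⟩ : ∃ e, e 1 0 ≠ 0 ∧ trace (A * e) = 0 ∧
      trace (A * (!![0, 1, 0; 0, 0, 0; 0, 0, t] * e)) = 0 ∧
      trace (A * (e * !![0, 1, 0; 0, 0, 0; 0, 0, t])) = 0 := by
    by_cases hb : ∃ b ∈ V, b 1 0 ≠ 0
    · obtain ⟨b, hb, hb0⟩ := hb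
      exact ⟨b, hb0, H.one _ hb, H.two _ hN _ hb, H.two _ hb _ hN⟩
    · push Not at hb
      obtain ⟨b, hbV, j, hj, hbj⟩ := H.exists_col_ne 0
      obtain ⟨c, hcV, k, hk, hck⟩ := H.exists_row_ne 1
      have hb1 : b 2 0 ≠ 0 := by
        fin_cases j
        · simp at hj
        · exact absurd (hb b hbV) hbj
        · exact hbj
      have hc1 : c 1 2 ≠ 0 := by
        fin_cases k
        · exact absurd (hb c hcV) hck
        · simp at hk
        · exact hck
      refine ⟨c * b, ?_, H.two _ hcV _ hbV, ?_, H.three _ hcV _ hbV _ hN⟩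
      · simp [Matrix.mul_apply, Fin.sum_univ_three, hb b hbV, hb c hcV, hb1, hc1]
      · rw [← mul_assoc _ c b]
        exact H.three _ hN _ hcV _ hbV
  have a00 : A 0 0 = 0 := by
    simpa [a20, he] using left e (by simp [a12, a02]) e2
  have a11 : A 1 1 = 0 := by
    simpa [a12, he] using right e (by simp [a20, a21]) e3
  have a01 : A 0 1 = 0 := by
    simpa [a00, a11, he] using all e (by simp [a12, a02]) (by simp [a20, a21]) e1
  ext i j
  fin_cases i <;> fin_cases j <;> simp_all

theorem eq_zero_of_diagonal (H : IsObstruction A V) {s t : K} (hs : s ≠ 0) (ht : t ≠ 0)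
    (hst : s ≠ t) (h1 : 1 ∈ V) (ha : !![0, 0, 0; 0, s, 0; 0, 0, t] ∈ V) : A = 0 := by
  have hst' : s - t ≠ 0 := sub_ne_zero.mpr hst
  have sq : (!![0, 0, 0; 0, s, 0; 0, 0, t] * !![0, 0, 0; 0, s, 0; 0, 0, t] :
      Matrix (Fin 3) (Fin 3) K) = !![0, 0, 0; 0, s * s, 0; 0, 0, t * t] := by
    ext i j
    fin_cases i <;> fin_cases j <;> simp [Matrix.mul_apply, Fin.sum_univ_three]
  -- each diagonal matrix unit is a combination of `1`, `a` and `a²`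
  have row : ∀ e, trace (A * e) = 0 → trace (A * (!![0, 0, 0; 0, s, 0; 0, 0, t] * e)) = 0 →
      trace (A * (!![0, 0, 0; 0, s, 0; 0, 0, t] * !![0, 0, 0; 0, s, 0; 0, 0, t] * e)) = 0 →
      ∀ i, ∑ j, e i j * A j i = 0 := by
    intro e h0 h1 h2
    rw [sq] at h2
    simp [-cons_mul, trace, Matrix.mul_apply, Fin.sum_univ_three] at h0 h1 h2
    have r1 : s * (s - t) * (∑ j, e 1 j * A j 1) = 0 := by
      simp only [Fin.sum_univ_three]
      linear_combination h2 - t * h1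
    have r2 : t * (s - t) * (∑ j, e 2 j * A j 2) = 0 := by
      simp only [Fin.sum_univ_three]
      linear_combination s * h1 - h2
    simp only [mul_eq_zero, hs, ht, hst', false_or] at r1 r2
    intro i
    fin_cases i
    · simp only [Fin.sum_univ_three] at r1 r2 ⊢
      simp
      linear_combination h0 - r1 - r2
    · exact r1
    · exact r2
  have row1 : ∀ b ∈ V, ∀ i, ∑ j, b i j * A j i = 0 := fun b hb =>
    row b (H.one _ hb) (H.two _ ha _ hb) (H.three _ ha _ ha _ hb)
  have row2 : ∀ b ∈ V, ∀ c ∈ V, ∀ i, ∑ j, (b * c) i j * A j i = 0 := by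
    intro b hb c hc
    refine row (b * c) (H.two _ hb _ hc) ?_ ?_
    · rw [← mul_assoc _ b c]
      exact H.three _ ha _ hb _ hc
    · rw [← mul_assoc _ b c]
      exact H.four _ ha _ ha _ hb _ hc
  have diag : ∀ i, A i i = 0 := by
    intro i
    have := row1 1 h1 i
    simpa [Matrix.one_apply] using this
  have vanish : ∀ x : Fin 3 → K, ∑ j, x j = 0 → x 1 * s + x 2 * t = 0 →
      (∃ i, x i = 0) → ∀ j, x j = 0 := by
    intro x h0 h1 ⟨i, hi⟩
    rw [Fin.sum_univ_three] at h0
    have h2 : x 2 = 0 := by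
      fin_cases i <;> simp only [Fin.zero_eta, Fin.mk_one, Fin.reduceFinMk] at hi
      · have : (s - t) * x 2 = 0 := by linear_combination s * h0 - s * hi - h1
        simpa [hst'] using this
      · simpa [hi, ht] using h1
      · exact hi
    have h3 : x 1 = 0 := by simpa [h2, hs] using h1
    intro j
    fin_cases j
    · simpa [h2, h3] using h0
    · exact h3
    · exact h2
  have off : ∀ b ∈ V, ∀ i j, b i j * A j i = 0 := by
    intro b hb i
    refine vanish (fun j => b i j * A j i) (row1 b hb i) ?_ ⟨i, by simp [diag]⟩
    have h1 := row2 b hb _ ha i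
    simp [-cons_mul, Matrix.mul_apply, Fin.sum_univ_three] at h1
    linear_combination h1
  have main : ∀ i j k, (∀ g : Fin 3 → K, ∑ x, g x = g i + g j + g k) →
      (∀ x, x = i ∨ x = j ∨ x = k) → A j i = 0 := by
    intro i j k hsum hall
    by_contra hA
    have hb : ∀ b ∈ V, b i j = 0 := by
      intro b hb
      simpa [hA] using off b hb i j
    obtain ⟨b, hbV, l, hl, hbl⟩ := H.exists_row_ne i
    obtain ⟨c, hcV, m, hm, hcm⟩ := H.exists_col_ne j
    have hbk : b i k ≠ 0 := by
      rcases hall l with rfl | rfl | rfl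
      · exact absurd rfl hl
      · exact absurd (hb b hbV) hbl
      · exact hbl
    have hck : c k j ≠ 0 := by
      rcases hall m with rfl | rfl | rfl
      · exact absurd (hb c hcV) hcm
      · exact absurd rfl hm
      · exact hcm
    have hAk : A k i = 0 := by simpa [hbk] using off b hbV i k
    have := row2 b hbV c hcV i
    simp [hsum, Matrix.mul_apply, diag, hAk, hA, hb b hbV, hb c hcV, hbk, hck] at this
  ext i j
  fin_cases i <;> fin_cases j <;> simp only [Matrix.zero_apply]
  · exact diag 0
  · exact main 1 0 2 (fun g => by rw [Fin.sum_univ_three]; ring) (by decide)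
  · exact main 2 0 1 (fun g => by rw [Fin.sum_univ_three]; ring) (by decide)
  · exact main 0 1 2 (fun g => by rw [Fin.sum_univ_three]) (by decide)
  · exact diag 1
  · exact main 2 1 0 (fun g => by rw [Fin.sum_univ_three]; ring) (by decide)
  · exact main 0 2 1 (fun g => by rw [Fin.sum_univ_three]; ring) (by decide)
  · exact main 1 2 0 (fun g => by rw [Fin.sum_univ_three]; ring) (by decide)
  · exact diag 2

theorem eq_zero_of_minorSum (H : IsObstruction A V) {a : Matrix (Fin 3) (Fin 3) K} (ha : a ∈ V)
    (hne : a ≠ 0) (hdet : det a = 0) (hs : minorSum a = 0) : A = 0 := by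
  by_cases hq : a * a = trace a • a
  · obtain ⟨u, w, rfl⟩ := exists_eq_vecMulVec hne hs hq
    exact H.eq_zero_of_vecMulVec ha hne
  have hcube : a * a * a = trace a • (a * a) := by
    have := cayley_hamilton_three a
    rw [hdet, hs, zero_smul, zero_smul, add_zero] at this
    exact sub_eq_zero.mp this
  obtain ⟨u, hu⟩ : ∃ u, (a * a - trace a • a) *ᵥ u ≠ 0 := by
    by_contra! h
    apply hq
    rw [← sub_eq_zero]
    exact Matrix.mulVec_injective (funext fun u => by rw [h, zero_mulVec])
  have htr : a * a = 0 → trace a = 0 := by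
    intro h
    have : trace (a * a) = trace a ^ 2 - 2 * minorSum a := by
      simp [minorSum, trace, Matrix.mul_apply, Fin.sum_univ_three]
      ring
    rw [h, hs] at this
    simpa using this.symm
  generalize trace a = t at *
  set v₂ := a *ᵥ u - t • u with hv₂
  set v₁ := a *ᵥ v₂ with hv₁
  have hv₁0 : v₁ ≠ 0 := by
    rw [hv₁, hv₂, mulVec_sub, mulVec_mulVec, mulVec_smul]
    rwa [sub_mulVec, smul_mulVec] at hu
  have hav₁ : a *ᵥ v₁ = 0 := by
    rw [hv₁, hv₂, mulVec_mulVec, mulVec_sub, mulVec_smul, mulVec_mulVec, hcube, smul_mulVec,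
      sub_self]
  clear_value v₁
  have hP : ∀ (v₃ : Fin 3 → K) (c : Fin 3 → K), (Matrix.of ![v₁, v₂, v₃])ᵀ *ᵥ c =
      c 0 • v₁ + c 1 • v₂ + c 2 • v₃ := by
    intro v₃ c
    ext i
    simp [mulVec, dotProduct, Fin.sum_univ_three]
    ring
  have hcz : ∀ c : K, c • v₁ = 0 → c = 0 := fun c h => by simpa [hv₁0] using h
  by_cases ht : t = 0
  · subst ht
    have hau : a *ᵥ u = v₂ := by simp [hv₂]
    clear_value v₂
    refine H.eq_zero_of_conj (P := (Matrix.of ![v₁, v₂, u])ᵀ) ?_ ha ?_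
      fun A' V' H' hJ _ => H'.eq_zero_of_nilpotent hJ
    · apply det_ne_zero_of_mulVec
      intro c hc
      rw [hP] at hc
      have e1 := congrArg (a *ᵥ ·) hc
      simp only [mulVec_add, mulVec_smul, hav₁, hau, ← hv₁, mulVec_zero, smul_zero,
        zero_add] at e1
      have e2 := congrArg (a *ᵥ ·) e1
      simp only [mulVec_add, mulVec_smul, hav₁, ← hv₁, mulVec_zero, smul_zero,
        zero_add] at e2
      have c2 := hcz _ e2
      rw [c2, zero_smul, add_zero] at e1
      have c1 := hcz _ e1
      rw [c1, c2, zero_smul, zero_smul, add_zero, add_zero] at hc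
      have c0 := hcz _ hc
      ext i
      fin_cases i <;> assumption
    · have h1 : ∀ i, ∑ j, a i j * v₁ j = 0 := fun i => congrFun hav₁ i
      have h2 : ∀ i, ∑ j, a i j * v₂ j = v₁ i := fun i => (congrFun hv₁ i).symm
      have h3 : ∀ i, ∑ j, a i j * u j = v₂ i := fun i => congrFun hau i
      ext i j
      fin_cases j <;> simp [-cons_mul, Matrix.mul_apply, h1, h2, h3] <;>
        simp [Fin.sum_univ_three]
  · obtain ⟨x, hx⟩ : ∃ x, (a * a) *ᵥ x ≠ 0 := by
      by_contra! h
      exact ht (htr (Matrix.mulVec_injective (funext fun u => by rw [h, zero_mulVec])))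
    set v₃ := (a * a) *ᵥ x with hv₃
    have hav₃ : a *ᵥ v₃ = t • v₃ := by
      rw [hv₃, mulVec_mulVec, ← mul_assoc, hcube, smul_mulVec]
    clear_value v₂ v₃
    refine H.eq_zero_of_conj (P := (Matrix.of ![v₁, v₂, v₃])ᵀ) ?_ ha ?_
      fun A' V' H' hJ _ => H'.eq_zero_of_jordan ht hJ
    · apply det_ne_zero_of_mulVec
      intro c hc
      rw [hP] at hc
      have e1 := congrArg (a *ᵥ ·) hc
      simp only [mulVec_add, mulVec_smul, hav₁, hav₃, ← hv₁, mulVec_zero, smul_zero,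
        zero_add] at e1
      have e2 := congrArg (a *ᵥ ·) e1
      simp only [mulVec_add, mulVec_smul, hav₁, hav₃, mulVec_zero, smul_zero,
        zero_add] at e2
      have c2 : c 2 = 0 := by simpa [ht, hx] using e2
      rw [c2, zero_smul, add_zero] at e1
      have c1 := hcz _ e1
      rw [c1, c2, zero_smul, zero_smul, add_zero, add_zero] at hc
      have c0 := hcz _ hc
      ext i
      fin_cases i <;> assumption
    · have h1 : ∀ i, ∑ j, a i j * v₁ j = 0 := fun i => congrFun hav₁ i
      have h2 : ∀ i, ∑ j, a i j * v₂ j = v₁ i := fun i => (congrFun hv₁ i).symm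
      have h3 : ∀ i, ∑ j, a i j * v₃ j = t * v₃ i := fun i => congrFun hav₃ i
      ext i j
      fin_cases j <;> simp [-cons_mul, Matrix.mul_apply, h1, h2, h3] <;>
        simp [Fin.sum_univ_three, mul_comm]

theorem eq_zero_of_distinct (H : IsObstruction A V) {a : Matrix (Fin 3) (Fin 3) K} (ha : a ∈ V)
    (h1 : 1 ∈ V) {s t : K} (hs : s ≠ 0) (ht : t ≠ 0) (hst : s ≠ t) (hdet : det a = 0)
    (hdets : det (a - s • 1) = 0) (hdett : det (a - t • 1) = 0) : A = 0 := by
  obtain ⟨v₁, hv₁, e₁⟩ := Matrix.exists_mulVec_eq_zero_iff.mpr hdet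
  obtain ⟨v₂, hv₂, e₂⟩ := Matrix.exists_mulVec_eq_zero_iff.mpr hdets
  obtain ⟨v₃, hv₃, e₃⟩ := Matrix.exists_mulVec_eq_zero_iff.mpr hdett
  rw [sub_mulVec, smul_mulVec, one_mulVec, sub_eq_zero] at e₂ e₃
  refine H.eq_zero_of_conj (P := (Matrix.of ![v₁, v₂, v₃])ᵀ) ?_ ha ?_
      fun A' V' H' hJ h1' => H'.eq_zero_of_diagonal hs ht hst (h1' h1) hJ
  · apply det_ne_zero_of_mulVec
    intro c hc
    have hP : (Matrix.of ![v₁, v₂, v₃])ᵀ *ᵥ c = c 0 • v₁ + c 1 • v₂ + c 2 • v₃ := by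
      ext i
      simp [mulVec, dotProduct, Fin.sum_univ_three]
      ring
    rw [hP] at hc
    have f1 := congrArg (a *ᵥ ·) hc
    simp only [mulVec_add, mulVec_smul, e₁, e₂, e₃, mulVec_zero, smul_zero, zero_add] at f1
    have f2 := congrArg (a *ᵥ ·) f1
    simp only [mulVec_add, mulVec_smul, e₂, e₃, mulVec_zero] at f2
    have c2 : c 2 = 0 := by
      have : (c 2 * t * (t - s)) • v₃ = 0 := by
        linear_combination (norm := module) f2 - s • f1
      simpa [hv₃, ht, sub_ne_zero.mpr hst.symm] using this
    rw [c2, zero_smul, add_zero] at f1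
    have c1 : c 1 = 0 := by simpa [hv₂, hs] using f1
    rw [c1, c2, zero_smul, zero_smul, add_zero, add_zero] at hc
    have c0 : c 0 = 0 := by simpa [hv₁] using hc
    ext i
    fin_cases i <;> assumption
  · have h1 : ∀ i, ∑ j, a i j * v₁ j = 0 := fun i => congrFun e₁ i
    have h2 : ∀ i, ∑ j, a i j * v₂ j = s * v₂ i := fun i => congrFun e₂ i
    have h3 : ∀ i, ∑ j, a i j * v₃ j = t * v₃ i := fun i => congrFun e₃ i
    ext i j
    fin_cases j <;> simp [-cons_mul, Matrix.mul_apply, h1, h2, h3] <;>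
      simp [Fin.sum_univ_three, mul_comm]

theorem exists_ne_smul (H : IsObstruction A V) :
    ∃ b ∈ V, ∀ c : K, b ≠ c • 1 := by
  obtain ⟨b, hb, h⟩ := H.col (Pi.single 0 1) (by simp)
  refine ⟨b, hb, ?_⟩
  rintro c rfl
  exact h c (by rw [smul_mulVec, one_mulVec])

theorem sup_one (H : IsObstruction A V) (hA : trace A = 0) :
    IsObstruction A (V ⊔ Submodule.span K {1}) := by
  have mem : ∀ x ∈ V ⊔ Submodule.span K {(1 : Matrix (Fin 3) (Fin 3) K)},
      ∃ y ∈ V, ∃ c : K, y + c • (1 : Matrix (Fin 3) (Fin 3) K) = x := by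
    intro x hx
    obtain ⟨y, hy, z, hz, rfl⟩ := Submodule.mem_sup.mp hx
    obtain ⟨c, rfl⟩ := Submodule.mem_span_singleton.mp hz
    exact ⟨y, hy, c, rfl⟩
  have four : ∀ x ∈ V ⊔ Submodule.span K {1}, ∀ y ∈ V ⊔ Submodule.span K {1},
      ∀ z ∈ V ⊔ Submodule.span K {1}, ∀ w ∈ V ⊔ Submodule.span K {1},
      trace (A * (x * y * z * w)) = 0 := by
    intro x hx y hy z hz w hw
    obtain ⟨x', hx', c, rfl⟩ := mem x hx
    obtain ⟨y', hy', d, rfl⟩ := mem y hy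
    obtain ⟨z', hz', e, rfl⟩ := mem z hz
    obtain ⟨w', hw', f, rfl⟩ := mem w hw
    simp only [mul_add, add_mul, mul_smul_comm, smul_mul_assoc, mul_one, one_mul, trace_add,
      trace_smul, smul_eq_mul, hA, H.one x' hx', H.one y' hy', H.one z' hz', H.one w' hw',
      H.two x' hx' y' hy', H.two x' hx' z' hz', H.two x' hx' w' hw', H.two y' hy' z' hz',
      H.two y' hy' w' hw', H.two z' hz' w' hw', H.three x' hx' y' hy' z' hz',
      H.three x' hx' y' hy' w' hw', H.three x' hx' z' hz' w' hw', H.three y' hy' z' hz' w' hw',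
      H.four x' hx' y' hy' z' hz' w' hw', mul_zero, add_zero]
  have h1 : (1 : Matrix (Fin 3) (Fin 3) K) ∈ V ⊔ Submodule.span K {1} :=
    Submodule.mem_sup_right (Submodule.mem_span_singleton_self _)
  refine ⟨fun x hx => ?_, fun x hx y hy => ?_, fun x hx y hy z hz => ?_, four,
    fun v hv => ?_, fun v hv => ?_⟩
  · simpa using four x hx 1 h1 1 h1 1 h1
  · simpa using four x hx y hy 1 h1 1 h1
  · simpa using four x hx y hy z hz 1 h1
  · obtain ⟨b, hb, h⟩ := H.col v hv
    exact ⟨b, Submodule.mem_sup_left hb, h⟩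
  · obtain ⟨b, hb, h⟩ := H.row v hv
    exact ⟨b, Submodule.mem_sup_left hb, h⟩

variable [IsAlgClosed K]

theorem exists_det_sub_smul_one (a : Matrix (Fin 3) (Fin 3) K) :
    ∃ r : K, det (a - r • 1) = 0 := by
  obtain ⟨r, hr⟩ := IsAlgClosed.exists_root a.charpoly (by
    rw [charpoly_degree_eq_dim]; simp)
  refine ⟨r, ?_⟩
  rw [Polynomial.IsRoot, eval_charpoly] at hr
  rw [← neg_sub, det_neg, smul_one_eq_diagonal, ← scalar_apply, hr, mul_zero]

theorem exists_quadratic_root {p : K} (hp : p ≠ 0) (q r : K) :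
    ∃ x : K, p * x ^ 2 + q * x + r = 0 := by
  obtain ⟨x, hx⟩ := IsAlgClosed.exists_root
    (Polynomial.C p * Polynomial.X ^ 2 + Polynomial.C q * Polynomial.X + Polynomial.C r)
    (by rw [Polynomial.degree_quadratic hp]; simp)
  exact ⟨x, by simpa [Polynomial.IsRoot] using hx⟩

theorem exists_minorSum_eq_zero (H : IsObstruction A V) :
    ∃ a ∈ V, a ≠ 0 ∧ minorSum a = 0 := by
  obtain ⟨y, hy, hyne⟩ := H.exists_ne_smul
  have hy0 : y ≠ 0 := by simpa using hyne 0
  by_cases hs : minorSum y = 0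
  · exact ⟨y, hy, hy0, hs⟩
  obtain ⟨r, hr⟩ := exists_det_sub_smul_one y
  obtain ⟨v, hv, hyv⟩ := Matrix.exists_mulVec_eq_zero_iff.mpr hr
  rw [sub_mulVec, smul_mulVec, one_mulVec, sub_eq_zero] at hyv
  obtain ⟨x, hx, hxv⟩ := H.col v hv
  obtain ⟨c, hc⟩ := exists_quadratic_root hs
    (minorSum (x + y) - minorSum x - minorSum y) (minorSum x)
  refine ⟨x + c • y, V.add_mem hx (V.smul_mem c hy), fun h0 => ?_, ?_⟩
  · apply hxv (-(c * r))
    rw [eq_neg_of_add_eq_zero_left h0, neg_mulVec, smul_mulVec, hyv, smul_smul, neg_smul]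
  · rw [← hc]
    simp [minorSum]
    ring

theorem eq_zero (H : IsObstruction A V) : A = 0 := by
  by_cases hA : trace A = 0
  · have H' := H.sup_one hA
    have h1 : (1 : Matrix (Fin 3) (Fin 3) K) ∈ V ⊔ Submodule.span K {1} :=
      Submodule.mem_sup_right (Submodule.mem_span_singleton_self _)
    obtain ⟨b, hb, hbne⟩ := H'.exists_ne_smul
    obtain ⟨r, hr⟩ := exists_det_sub_smul_one b
    have ha := Submodule.sub_mem _ hb (Submodule.smul_mem _ r h1)
    have hane : ∀ c : K, b - r • 1 - c • 1 ≠ 0 := by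
      intro c h
      rw [sub_sub, ← add_smul] at h
      exact hbne _ (sub_eq_zero.mp h)
    generalize b - r • (1 : Matrix (Fin 3) (Fin 3) K) = a at *
    by_cases hs : minorSum a = 0
    · exact H'.eq_zero_of_minorSum ha (by simpa using hane 0) hr hs
    obtain ⟨s, hs'⟩ := exists_quadratic_root one_ne_zero (-trace a) (minorSum a)
    have hs0 : s ≠ 0 := by
      rintro rfl
      exact hs (by simpa using hs')
    have hdet : det (a - s • 1) = 0 := by
      rw [det_sub_smul_one]
      linear_combination hr - s * hs'
    have ht0 : trace a - s ≠ 0 := by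
      intro h
      exact hs (by linear_combination hs' + s * h)
    by_cases hst : s = trace a - s
    · refine H'.eq_zero_of_minorSum (Submodule.sub_mem _ ha (Submodule.smul_mem _ s h1)) (hane s)
        hdet ?_
      rw [minorSum_sub_smul_one]
      linear_combination hs' + s * hst
    · refine H'.eq_zero_of_distinct ha h1 hs0 ht0 hst hr hdet ?_
      rw [det_sub_smul_one]
      linear_combination hr - (trace a - s) * hs'
  · obtain ⟨a, ha, hne, hs⟩ := H.exists_minorSum_eq_zero
    refine H.eq_zero_of_minorSum ha hne ?_ hs
    have := congrArg (fun x => trace (A * x)) (cayley_hamilton_three a)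
    simp only [mul_add, mul_sub, mul_smul_comm, trace_add, trace_sub, trace_smul,
      H.three a ha a ha a ha, H.two a ha a ha, H.one a ha, mul_one, mul_zero, sub_zero,
      add_zero, smul_eq_mul] at this
    exact (mul_eq_zero.mp this.symm).resolve_right hA

end IsObstruction

section BaseChange

variable {F : Type*} [Field F] (K : Type*) [Field K] [Algebra F K]
  {S : Set (Matrix (Fin 3) (Fin 3) F)}

theorem exists_mulVec_ne_smul (hgen : Algebra.adjoin F S = ⊤) {v : Fin 3 → K} (hv : v ≠ 0) :
    ∃ b ∈ S, ∀ c : K, b.map (algebraMap F K) *ᵥ v ≠ c • v := by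
  by_contra! h
  have key : ∀ x : Matrix (Fin 3) (Fin 3) F, ∃ c : K, x.map (algebraMap F K) *ᵥ v = c • v := by
    intro x
    have hx : x ∈ Algebra.adjoin F S := hgen ▸ Algebra.mem_top
    induction hx using Algebra.adjoin_induction with
    | mem x hx => exact h x hx
    | algebraMap r =>
      refine ⟨algebraMap F K r, ?_⟩
      ext i
      simp [mulVec, dotProduct, Matrix.algebraMap_matrix_apply, apply_ite (algebraMap F K)]
    | add x y _ _ hx hy =>
      obtain ⟨c, hc⟩ := hx
      obtain ⟨d, hd⟩ := hy
      exact ⟨c + d, by rw [Matrix.map_add _ (map_add _), add_mulVec, hc, hd, add_smul]⟩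
    | mul x y _ _ hx hy =>
      obtain ⟨c, hc⟩ := hx
      obtain ⟨d, hd⟩ := hy
      exact ⟨d * c, by rw [Matrix.map_mul, ← mulVec_mulVec, hd, mulVec_smul, hc, smul_smul]⟩
  obtain ⟨i, hi⟩ := Function.ne_iff.mp hv
  obtain ⟨j, hj⟩ := exists_ne i
  obtain ⟨c, hc⟩ := key (Matrix.single j i 1)
  rw [Matrix.map_single _ _ _ (algebraMap F K), map_one] at hc
  have h1 := congrFun hc i
  have h2 := congrFun hc j
  simp [mulVec, dotProduct, Matrix.single_apply, hj] at h1 h2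
  simp_all

theorem adjoin_transpose (hgen : Algebra.adjoin F S = ⊤) :
    Algebra.adjoin F ((fun x => xᵀ) '' S) = ⊤ := by
  rw [eq_top_iff]
  rintro y -
  have key : ∀ x : Matrix (Fin 3) (Fin 3) F, xᵀ ∈ Algebra.adjoin F ((fun x => xᵀ) '' S) := by
    intro x
    have hx : x ∈ Algebra.adjoin F S := hgen ▸ Algebra.mem_top
    induction hx using Algebra.adjoin_induction with
    | mem x hx => exact Algebra.subset_adjoin ⟨x, hx, rfl⟩
    | algebraMap r =>
      rw [Matrix.algebraMap_eq_diagonal, diagonal_transpose, ← Matrix.algebraMap_eq_diagonal]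
      exact Subalgebra.algebraMap_mem _ r
    | add x y _ _ hx hy => rw [transpose_add]; exact add_mem hx hy
    | mul x y _ _ hx hy => rw [transpose_mul]; exact mul_mem hy hx
  simpa using key yᵀ

theorem exists_vecMul_ne_smul (hgen : Algebra.adjoin F S = ⊤) {v : Fin 3 → K} (hv : v ≠ 0) :
    ∃ b ∈ S, ∀ c : K, v ᵥ* b.map (algebraMap F K) ≠ c • v := by
  obtain ⟨_, ⟨b, hb, rfl⟩, h⟩ := exists_mulVec_ne_smul K (adjoin_transpose hgen) hv
  refine ⟨b, hb, fun c hc => h c ?_⟩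
  rw [← hc, ← mulVec_transpose, transpose_map]

theorem trace_mul_eq_zero_of_mem_span {T : Set (Matrix (Fin 3) (Fin 3) K)}
    {L : Matrix (Fin 3) (Fin 3) K} (h : ∀ x ∈ T, trace (L * x) = 0) :
    ∀ x ∈ Submodule.span K T, trace (L * x) = 0 := by
  intro x hx
  induction hx using Submodule.span_induction with
  | mem x hx => exact h x hx
  | zero => simp
  | add x y _ _ hx hy => rw [mul_add, trace_add, hx, hy, add_zero]
  | smul c x _ hx => rw [mul_smul_comm, trace_smul, hx, smul_zero]

theorem isObstruction_map (hgen : Algebra.adjoin F S = ⊤) {A : Matrix (Fin 3) (Fin 3) F}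
    (hA : ∀ x ∈ wordSpan0 F 3 4 S, trace (A * x) = 0) :
    IsObstruction (A.map (algebraMap F K))
      (Submodule.span K ((fun x => x.map (algebraMap F K)) '' S)) := by
  have word : ∀ w : List (Matrix (Fin 3) (Fin 3) F), 1 ≤ w.length → w.length ≤ 4 →
      (∀ x ∈ w, x ∈ S) → trace (w.prod.map (algebraMap F K) * A.map (algebraMap F K)) = 0 := by
    intro w h1 h4 hw
    rw [trace_mul_comm, ← Matrix.map_mul]
    have := hA _ (Submodule.subset_span ⟨w, h1, h4, hw, rfl⟩)
    simpa only [trace, diag_apply, map_sum, map_zero, Matrix.map_apply] using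
      congrArg (algebraMap F K) this
  constructor
  · intro x hx
    refine trace_mul_eq_zero_of_mem_span K ?_ x hx
    rintro _ ⟨x, hx, rfl⟩
    rw [trace_mul_comm]
    simpa [mul_assoc, Matrix.map_mul] using
      word [x] (by simp) (by simp) (by simp [hx])
  · intro x hx y hy
    simp only [← mul_assoc]
    refine trace_mul_eq_zero_of_mem_span K ?_ y hy
    rintro _ ⟨y, hy, rfl⟩
    rw [trace_mul_comm]
    simp only [← mul_assoc]
    refine trace_mul_eq_zero_of_mem_span K ?_ x hx
    rintro _ ⟨x, hx, rfl⟩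
    rw [trace_mul_comm]
    simpa [mul_assoc, Matrix.map_mul] using
      word [x, y] (by simp) (by simp) (by simp [hx, hy])
  · intro x hx y hy z hz
    simp only [← mul_assoc]
    refine trace_mul_eq_zero_of_mem_span K ?_ z hz
    rintro _ ⟨z, hz, rfl⟩
    rw [trace_mul_comm]
    simp only [← mul_assoc]
    refine trace_mul_eq_zero_of_mem_span K ?_ y hy
    rintro _ ⟨y, hy, rfl⟩
    rw [trace_mul_comm]
    simp only [← mul_assoc]
    refine trace_mul_eq_zero_of_mem_span K ?_ x hx
    rintro _ ⟨x, hx, rfl⟩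
    rw [trace_mul_comm]
    simpa [mul_assoc, Matrix.map_mul] using
      word [x, y, z] (by simp) (by simp) (by simp [hx, hy, hz])
  · intro x hx y hy z hz w hw
    simp only [← mul_assoc]
    refine trace_mul_eq_zero_of_mem_span K ?_ w hw
    rintro _ ⟨w, hw, rfl⟩
    rw [trace_mul_comm]
    simp only [← mul_assoc]
    refine trace_mul_eq_zero_of_mem_span K ?_ z hz
    rintro _ ⟨z, hz, rfl⟩
    rw [trace_mul_comm]
    simp only [← mul_assoc]
    refine trace_mul_eq_zero_of_mem_span K ?_ y hy
    rintro _ ⟨y, hy, rfl⟩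
    rw [trace_mul_comm]
    simp only [← mul_assoc]
    refine trace_mul_eq_zero_of_mem_span K ?_ x hx
    rintro _ ⟨x, hx, rfl⟩
    rw [trace_mul_comm]
    simpa [mul_assoc, Matrix.map_mul] using
      word [x, y, z, w] (by simp) (by simp) (by simp [hx, hy, hz, hw])
  · intro v hv
    obtain ⟨b, hb, h⟩ := exists_mulVec_ne_smul K hgen hv
    exact ⟨_, Submodule.subset_span ⟨b, hb, rfl⟩, h⟩
  · intro v hv
    obtain ⟨b, hb, h⟩ := exists_vecMul_ne_smul K hgen hv
    exact ⟨_, Submodule.subset_span ⟨b, hb, rfl⟩, h⟩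

end BaseChange

/-- For every generating set `S` of `M_3(F)`, the span of words of length between `1` and
`4` is all of `M_3(F)`; i.e. `l_0(S) ≤ 4`. -/
theorem stmt_5 (F : Type*) [Field F] (S : Set (Matrix (Fin 3) (Fin 3) F))
    (hgen : Algebra.adjoin F S = ⊤) :
    wordSpan0 F 3 4 S = ⊤ := by
  by_contra hne
  obtain ⟨f, hf, hle⟩ := Submodule.exists_le_ker_of_lt_top _ (lt_top_iff_ne_top.mpr hne)
  have htr : ∀ x, trace (Matrix.of (fun i j => f (Matrix.single j i 1)) * x) = f x := by
    intro x
    conv_rhs => rw [matrix_eq_sum_single x]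
    simp only [trace, diag_apply, Matrix.mul_apply, of_apply, map_sum]
    rw [Finset.sum_comm]
    refine Finset.sum_congr rfl fun i _ => Finset.sum_congr rfl fun j _ => ?_
    have : single i j (x i j) = x i j • single i j 1 := by simp
    rw [this, map_smul, smul_eq_mul, mul_comm]
  have h0 := (isObstruction_map (AlgebraicClosure F) hgen
    (A := Matrix.of (fun i j => f (Matrix.single j i 1)))
    (fun x hx => (htr x).trans (hle hx))).eq_zero
  replace h0 := Matrix.map_injective (algebraMap F (AlgebraicClosure F)).injective
    (h0.trans (Matrix.map_zero _ (map_zero _)).symm)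
  apply hf
  ext x
  rw [← htr, h0]
  simp
end

section
/- Let n and i be positive integers with i < n and let d = gcd(n, i). Then the unital subalgebra of M_n(ℂ) generated by {J_n^i, (J_nᵀ)^{n−i}} is isomorphic, as a ℂ-algebra, to the full matrix algebra M_{n/d}(ℂ). -/
open Matrix

/-- The `n × n` nilpotent Jordan block over `ℂ`. -/
def jordan (n : ℕ) : Matrix (Fin n) (Fin n) ℂ :=
  Matrix.of fun a b => if (a : ℕ) + 1 = (b : ℕ) then 1 else 0

theorem jordan_pow_apply (n k : ℕ) (a b : Fin n) :
    (jordan n ^ k) a b = if (a : ℕ) + k = b then 1 else 0 := by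
  induction k generalizing b with
  | zero => simp [Matrix.one_apply, Fin.ext_iff]
  | succ k ih =>
    rw [pow_succ, Matrix.mul_apply]
    simp only [ih, ite_mul, one_mul, zero_mul]
    by_cases h : (a : ℕ) + k < n
    · rw [Finset.sum_eq_single ⟨a + k, h⟩]
      · simp [jordan, add_assoc]
      · intro c _ hc
        rw [if_neg]
        exact fun hac => hc (Fin.ext hac.symm)
      · simp
    · rw [if_neg (by omega)]
      exact Finset.sum_eq_zero fun c _ => if_neg (by have := c.2; omega)

theorem jordan_transpose_pow_apply (n k : ℕ) (a b : Fin n) :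
    ((jordan n)ᵀ ^ k) a b = if (b : ℕ) + k = a then 1 else 0 := by
  rw [← Matrix.transpose_pow, Matrix.transpose_apply, jordan_pow_apply]

/-- The permutation matrix of the cyclic shift by `s`. -/
def cyclicShift {m : ℕ} [NeZero m] (s : Fin m) : Matrix (Fin m) (Fin m) ℂ :=
  Matrix.of fun a b => if b = a + s then 1 else 0

section cyclicShift

variable {m : ℕ} [NeZero m]

theorem cyclicShift_mul_apply (s : Fin m) (M : Matrix (Fin m) (Fin m) ℂ) (a b : Fin m) :
    (cyclicShift s * M) a b = M (a + s) b := by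
  simp [cyclicShift, Matrix.mul_apply]

theorem mul_cyclicShift_apply (s : Fin m) (M : Matrix (Fin m) (Fin m) ℂ) (a b : Fin m) :
    (M * cyclicShift s) a b = M a (b - s) := by
  have h (c : Fin m) : b = c + s ↔ c = b - s := by rw [eq_sub_iff_add_eq, eq_comm]
  simp [cyclicShift, Matrix.mul_apply, h]

theorem cyclicShift_zero : cyclicShift (0 : Fin m) = 1 := by
  ext a b
  simp [cyclicShift, Matrix.one_apply, eq_comm]

theorem cyclicShift_mul (s t : Fin m) :
    cyclicShift s * cyclicShift t = cyclicShift (s + t) := by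
  ext a b
  rw [cyclicShift_mul_apply]
  simp [cyclicShift, add_assoc]

theorem cyclicShift_pow (s : Fin m) (k : ℕ) : cyclicShift s ^ k = cyclicShift (k • s) := by
  induction k with
  | zero => simp [cyclicShift_zero]
  | succ k ih => rw [pow_succ, ih, cyclicShift_mul, succ_nsmul]

theorem nsmul_ofNat (k i : ℕ) : k • Fin.ofNat m i = Fin.ofNat m (k * i) := by
  induction k with
  | zero => simp
  | succ k ih =>
    rw [succ_nsmul, ih, Nat.succ_mul]
    apply Fin.ext
    simp [Fin.val_add]

theorem cyclicShift_mem {S : Subalgebra ℂ (Matrix (Fin m) (Fin m) ℂ)} {i : ℕ}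
    (hc : Nat.Coprime m i) (hS : cyclicShift (Fin.ofNat m i) ∈ S) (s : Fin m) :
    cyclicShift s ∈ S := by
  obtain ⟨k, -, hk⟩ := Nat.exists_mul_mod_eq_of_coprime (s : ℕ) hc.symm (NeZero.ne m)
  have h : k • Fin.ofNat m i = s := by
    apply Fin.ext
    rw [nsmul_ofNat, Fin.val_ofNat, mul_comm, hk, Nat.mod_eq_of_lt s.2]
  rw [← h, ← cyclicShift_pow]
  exact S.pow_mem hS k

theorem eq_top_of_single_mem {S : Subalgebra ℂ (Matrix (Fin m) (Fin m) ℂ)}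
    (hC : ∀ s, cyclicShift s ∈ S) (h0 : Matrix.single 0 0 1 ∈ S) : S = ⊤ := by
  rw [eq_top_iff]
  rintro M -
  rw [Matrix.matrix_eq_sum_single M]
  refine S.sum_mem fun a _ => S.sum_mem fun b _ => ?_
  have h : Matrix.single a b (M a b) =
      M a b • (cyclicShift (-a) * Matrix.single 0 0 1 * cyclicShift b) := by
    ext x y
    simp only [Matrix.smul_apply, mul_cyclicShift_apply, cyclicShift_mul_apply,
      Matrix.single_apply, ← sub_eq_add_neg, eq_comm (a := (0 : Fin m)), sub_eq_zero,
      eq_comm (a := a), eq_comm (a := b), smul_eq_mul, mul_ite, mul_one, mul_zero]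
  rw [h]
  exact S.smul_mem (S.mul_mem (S.mul_mem (hC _) h0) (hC _)) _

theorem jordan_pow_add_transpose_pow {i : ℕ} (hi : 0 < i) (him : i < m) :
    jordan m ^ i + (jordan m)ᵀ ^ (m - i) = cyclicShift (Fin.ofNat m i) := by
  ext a b
  have ha := a.2
  have hb := b.2
  have h : (b = a + Fin.ofNat m i) ↔ (a : ℕ) + i = b ∨ (b : ℕ) + (m - i) = a := by
    rw [Fin.ext_iff, Fin.val_add]
    simp only [Fin.ofNat, Nat.add_mod_mod]
    rcases lt_or_ge ((a : ℕ) + i) m with h | h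
    · rw [Nat.mod_eq_of_lt h]
      omega
    · rw [Nat.mod_eq_sub_mod h, Nat.mod_eq_of_lt (by omega)]
      omega
  rw [Matrix.add_apply, jordan_pow_apply, jordan_transpose_pow_apply, cyclicShift,
    Matrix.of_apply]
  simp only [h]
  split_ifs <;> first | omega | simp

theorem adjoin_jordan_pow_eq_top {i : ℕ} (hi : 0 < i) (him : i < m) (hc : Nat.Coprime m i) :
    Algebra.adjoin ℂ ({jordan m ^ i, (jordan m)ᵀ ^ (m - i)} :
      Set (Matrix (Fin m) (Fin m) ℂ)) = ⊤ := by
  set S := Algebra.adjoin ℂ ({jordan m ^ i, (jordan m)ᵀ ^ (m - i)} :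
      Set (Matrix (Fin m) (Fin m) ℂ))
  have hA : jordan m ^ i ∈ S := Algebra.subset_adjoin (by simp)
  have hB : (jordan m)ᵀ ^ (m - i) ∈ S := Algebra.subset_adjoin (by simp)
  have hC : ∀ s, cyclicShift s ∈ S :=
    cyclicShift_mem hc (jordan_pow_add_transpose_pow hi him ▸ S.add_mem hA hB)
  let P : Matrix (Fin m) (Fin m) ℂ := Matrix.diagonal fun a => if (a : ℕ) + i < m then 1 else 0
  have hP : P ∈ S := by
    have h : P = jordan m ^ i * cyclicShift (-Fin.ofNat m i) := by
      ext a b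
      have ha := a.2
      have hb := b.2
      rw [mul_cyclicShift_apply, sub_neg_eq_add, jordan_pow_apply, Fin.val_add]
      simp only [P, Matrix.diagonal_apply, Fin.ext_iff, Fin.ofNat, Nat.add_mod_mod]
      rcases lt_or_ge ((b : ℕ) + i) m with h | h
      · rw [Nat.mod_eq_of_lt h]
        split_ifs <;> first | omega | rfl
      · rw [Nat.mod_eq_sub_mod h, Nat.mod_eq_of_lt (by omega)]
        split_ifs <;> first | omega | rfl
    rw [h]
    exact S.mul_mem hA (hC _)
  refine eq_top_of_single_mem hC ?_
  have h : Matrix.single 0 0 1 = P * (1 - cyclicShift (-1) * P * cyclicShift 1) := by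
    ext a b
    have ha := a.2
    have hb := b.2
    rw [Matrix.diagonal_mul, Matrix.sub_apply, mul_cyclicShift_apply, cyclicShift_mul_apply,
      ← sub_eq_add_neg]
    simp only [P, Matrix.diagonal_apply, Matrix.single_apply, Matrix.one_apply, sub_left_inj]
    by_cases hab : a = b
    · subst hab
      by_cases h0 : a = 0
      · subst h0
        have : ((-1 : Fin m) : ℕ) = m - 1 := by
          rw [Fin.val_neg]
          have : (1 : Fin m) ≠ 0 := by
            intro h
            have := congrArg Fin.val h
            rw [Fin.val_one', Nat.mod_eq_of_lt (by omega)] at this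
            simp at this
          rw [if_neg this, Fin.val_one', Nat.mod_eq_of_lt (by omega)]
        simp [this, him, show ¬ (m - 1 + i < m) by omega]
      · have h1 : ((a - 1 : Fin m) : ℕ) = a - 1 := Fin.val_sub_one_of_ne_zero h0
        simp only [h1, Ne.symm h0, false_and, if_true, if_false]
        by_cases h2 : (a : ℕ) + i < m
        · simp [h2, show (a : ℕ) - 1 + i < m by omega]
        · simp [h2]
    · rw [if_neg (by rintro ⟨rfl, rfl⟩; exact hab rfl)]
      simp [hab]
  rw [h]
  exact S.mul_mem hP (S.sub_mem S.one_mem (S.mul_mem (S.mul_mem (hC _) hP) (hC _)))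

end cyclicShift

/-- The algebra embedding `M_m(ℂ) → M_{md}(ℂ)` sending `X` to `X ⊗ 1`. -/
noncomputable def amplification (m d : ℕ) :
    Matrix (Fin m) (Fin m) ℂ →ₐ[ℂ] Matrix (Fin (m * d)) (Fin (m * d)) ℂ :=
  (Matrix.reindexAlgEquiv ℂ ℂ finProdFinEquiv).toAlgHom.comp
    { (Matrix.blockDiagonalRingHom (Fin m) (Fin d) ℂ).comp
        (Pi.constRingHom (Fin d) (Matrix (Fin m) (Fin m) ℂ)) with
      commutes' := fun r => by
        ext ⟨a, k⟩ ⟨b, l⟩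
        simp [Matrix.blockDiagonal_apply, Matrix.algebraMap_matrix_apply, Prod.ext_iff]
        split_ifs <;> simp_all }

theorem amplification_apply {m d : ℕ} (X : Matrix (Fin m) (Fin m) ℂ) (a b : Fin m)
    (k l : Fin d) :
    amplification m d X (finProdFinEquiv (a, k)) (finProdFinEquiv (b, l)) =
      if k = l then X a b else 0 := by
  simp [amplification, Matrix.blockDiagonal_apply]

theorem amplification_injective {m d : ℕ} (hd : 0 < d) :
    Function.Injective (amplification m d) := by
  intro X Y h
  ext a b
  have := congrFun (congrFun h (finProdFinEquiv (a, ⟨0, hd⟩))) (finProdFinEquiv (b, ⟨0, hd⟩))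
  simpa only [amplification_apply, if_true] using this

theorem add_mul_add_eq_iff {m d : ℕ} (a b : Fin m) (k l : Fin d) (i : ℕ) :
    (finProdFinEquiv (a, k) : ℕ) + i * d = finProdFinEquiv (b, l) ↔
      k = l ∧ (a : ℕ) + i = b := by
  have hk := k.2
  have hl := l.2
  simp only [finProdFinEquiv_apply_val, Fin.ext_iff]
  constructor
  · intro h
    have h' : (k : ℕ) + d * (a + i) = l + d * b := by linarith
    have h1 : (k : ℕ) = l := by
      have := congrArg (· % d) h'
      simpa [Nat.mod_eq_of_lt hk, Nat.mod_eq_of_lt hl] using this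
    rw [h1] at h'
    exact ⟨h1, Nat.eq_of_mul_eq_mul_left (by omega) (Nat.add_left_cancel h')⟩
  · rintro ⟨h1, h2⟩
    rw [h1, ← h2]
    ring

theorem amplification_jordan_pow (m d i : ℕ) :
    amplification m d (jordan m ^ i) = jordan (m * d) ^ (i * d) := by
  ext x y
  obtain ⟨⟨a, k⟩, rfl⟩ := finProdFinEquiv.surjective x
  obtain ⟨⟨b, l⟩, rfl⟩ := finProdFinEquiv.surjective y
  simp only [amplification_apply, jordan_pow_apply, add_mul_add_eq_iff, ite_and]

theorem amplification_jordan_transpose_pow (m d i : ℕ) :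
    amplification m d ((jordan m)ᵀ ^ i) = (jordan (m * d))ᵀ ^ (i * d) := by
  ext x y
  obtain ⟨⟨a, k⟩, rfl⟩ := finProdFinEquiv.surjective x
  obtain ⟨⟨b, l⟩, rfl⟩ := finProdFinEquiv.surjective y
  simp only [amplification_apply, jordan_transpose_pow_apply, add_mul_add_eq_iff, ite_and,
    eq_comm (a := l)]

/-- For `0 < i < n` with `d = gcd(n, i)`, the unital subalgebra of `M_n(ℂ)` generated by
`{J_n^i, (J_nᵀ)^{n-i}}` is isomorphic as a ℂ-algebra to `M_{n/d}(ℂ)`. -/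
theorem stmt_12 (n i : ℕ) (hi : 0 < i) (hin : i < n) (d : ℕ) (hd : d = Nat.gcd n i) :
    Nonempty
      ((Algebra.adjoin ℂ
          ({jordan n ^ i, (jordan n)ᵀ ^ (n - i)} : Set (Matrix (Fin n) (Fin n) ℂ))) ≃ₐ[ℂ]
        Matrix (Fin (n / d)) (Fin (n / d)) ℂ) := by
  have hd0 : 0 < d := hd ▸ Nat.gcd_pos_of_pos_right n hi
  obtain ⟨m, j, hc, hn, hj⟩ : ∃ m j, Nat.Coprime m j ∧ n = m * d ∧ i = j * d := by
    rw [hd]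
    exact Nat.exists_coprime n i
  clear hd
  subst hn hj
  have hjm : j < m := lt_of_mul_lt_mul_right hin d.zero_le
  have hj0 : 0 < j := Nat.pos_of_mul_pos_right hi
  have : NeZero m := ⟨by omega⟩
  rw [Nat.mul_div_cancel m hd0, ← Nat.sub_mul, ← amplification_jordan_pow,
    ← amplification_jordan_transpose_pow, ← Set.image_pair, ← AlgHom.map_adjoin,
    adjoin_jordan_pow_eq_top hj0 hjm hc, Algebra.map_top]
  exact ⟨(AlgEquiv.ofInjective _ (amplification_injective hd0)).symm⟩
end
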